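/- Let F be a field of characteristic different from 2, let a_1, …, a_n ∈ F*, let α = (a_1, …, a_n) ∈ k_n(F) = K_n^M(F)/2K_n^M(F), and let q = ⟨⟨a_1, …, a_n⟩⟩ be the corresponding n-fold Pfister quadratic form. Then q splits α and q neutralizes α; that is, for every field extension L/F, if q is isotropic over L then α becomes trivial in k_n(L), and for every v with a = q(v) ≠ 0, the class α ∪ (a) is trivial in k_{n+1}(L). -/

import Mathlib

universe u

open MvPolynomial

/-- A field `F` has the `C_n` property if every homogeneous polynomial of
positive degree `d` in more than `d ^ n` variables has a nontrivial zero. -/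
def IsCField (F : Type u) [Field F] (n : ℕ) : Prop :=
  ∀ (d N : ℕ), 0 < d → d ^ n < N →
    ∀ f : MvPolynomial (Fin N) F, f.IsHomogeneous d →
      ∃ x : Fin N → F, x ≠ 0 ∧ MvPolynomial.eval x f = 0

variable (F : Type u) [Field F]

/-- Multilinearity relations for Milnor K-theory. -/
def mlRel (n : ℕ) : Set (FreeAbelianGroup (Fin n → Fˣ)) :=
  {z | ∃ (a : Fin n → Fˣ) (i : Fin n) (u v : Fˣ), a i = u * v ∧
        z = FreeAbelianGroup.of a - FreeAbelianGroup.of (Function.update a i u)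
              - FreeAbelianGroup.of (Function.update a i v)}

/-- Steinberg relations for Milnor K-theory. -/
def stRel (n : ℕ) : Set (FreeAbelianGroup (Fin n → Fˣ)) :=
  {z | ∃ (a : Fin n → Fˣ) (i j : Fin n), (i : ℕ) + 1 = (j : ℕ) ∧
        ((a i : F) + (a j : F) = 1) ∧ z = FreeAbelianGroup.of a}

/-- The subgroup of relations defining the `n`-th Milnor K-group. -/
def milnorRel (n : ℕ) : AddSubgroup (FreeAbelianGroup (Fin n → Fˣ)) :=
  AddSubgroup.closure (mlRel F n ∪ stRel F n)

/-- The `n`-th Milnor K-group `K_n^M(F)`. -/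
def MilnorK (n : ℕ) : Type u :=
  FreeAbelianGroup (Fin n → Fˣ) ⧸ milnorRel F n

instance (n : ℕ) : AddCommGroup (MilnorK F n) :=
  QuotientAddGroup.Quotient.addCommGroup _

/-- The subgroup `p·K_n^M(F)` of `K_n^M(F)`. -/
def pMul (p n : ℕ) : AddSubgroup (MilnorK F n) :=
  AddSubgroup.closure {x | ∃ y : MilnorK F n, x = p • y}

/-- `k_n(F) = K_n^M(F)/pK_n^M(F)`. -/
def kMod (p n : ℕ) : Type u := MilnorK F n ⧸ pMul F p n

instance (p n : ℕ) : AddCommGroup (kMod F p n) :=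
  QuotientAddGroup.Quotient.addCommGroup _

/-- The symbol `(a 1, …, a n)` in `k_n(F)`. -/
def symbol (p : ℕ) {n : ℕ} (a : Fin n → Fˣ) : kMod F p n :=
  QuotientAddGroup.mk (QuotientAddGroup.mk (FreeAbelianGroup.of a))

section Res

variable (L : Type u) [Field L] [Algebra F L]

/-- The map on free abelian groups induced by extension of scalars on units. -/
def freeRes (n : ℕ) : FreeAbelianGroup (Fin n → Fˣ) →+ FreeAbelianGroup (Fin n → Lˣ) :=
  FreeAbelianGroup.map (fun a => (Units.map (algebraMap F L).toMonoidHom) ∘ a)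

theorem milnorRel_le_comap (n : ℕ) :
    milnorRel F n ≤ (milnorRel L n).comap (freeRes F L n) := by
  rw [milnorRel, AddSubgroup.closure_le]
  rintro z (⟨a, i, u, v, hai, rfl⟩ | ⟨a, i, j, hij, hsum, rfl⟩)
  · show freeRes F L n _ ∈ milnorRel L n
    rw [map_sub, map_sub, freeRes, FreeAbelianGroup.map_of_apply,
      FreeAbelianGroup.map_of_apply, FreeAbelianGroup.map_of_apply]
    refine AddSubgroup.subset_closure (Or.inl
      ⟨(Units.map (algebraMap F L).toMonoidHom) ∘ a, i,
        Units.map (algebraMap F L).toMonoidHom u,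
        Units.map (algebraMap F L).toMonoidHom v, by simp [hai], ?_⟩)
    rw [Function.comp_update, Function.comp_update]
  · show freeRes F L n _ ∈ milnorRel L n
    rw [freeRes, FreeAbelianGroup.map_of_apply]
    refine AddSubgroup.subset_closure (Or.inr
      ⟨(Units.map (algebraMap F L).toMonoidHom) ∘ a, i, j, hij, ?_, rfl⟩)
    simp only [Function.comp_apply, Units.coe_map, RingHom.toMonoidHom_eq_coe,
      MonoidHom.coe_coe]
    rw [← map_add, hsum, map_one]

/-- Restriction `K_n^M(F) → K_n^M(L)`. -/
def resMilnor (n : ℕ) : MilnorK F n →+ MilnorK L n :=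
  QuotientAddGroup.map _ _ (freeRes F L n) (milnorRel_le_comap F L n)

theorem pMul_le_comap (p n : ℕ) :
    pMul F p n ≤ (pMul L p n).comap (resMilnor F L n) := by
  rw [pMul, AddSubgroup.closure_le]
  rintro z ⟨y, rfl⟩
  exact AddSubgroup.subset_closure ⟨resMilnor F L n y, by rw [map_nsmul]⟩

/-- Restriction `k_n(F) → k_n(L)`. -/
def resK (p n : ℕ) : kMod F p n →+ kMod L p n :=
  QuotientAddGroup.map _ _ (resMilnor F L n) (pMul_le_comap F L p n)

end Res

section Cup

/-- The map on free abelian groups appending a fixed unit `c` to a tuple. -/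
def freeCup {n : ℕ} (c : Fˣ) :
    FreeAbelianGroup (Fin n → Fˣ) →+ FreeAbelianGroup (Fin (n + 1) → Fˣ) :=
  FreeAbelianGroup.map (fun a => Fin.snoc a c)

theorem milnorRel_le_comap_cup (n : ℕ) (c : Fˣ) :
    milnorRel F n ≤ (milnorRel F (n + 1)).comap (freeCup F c) := by
  rw [milnorRel, AddSubgroup.closure_le]
  rintro z (⟨a, i, u, v, hai, rfl⟩ | ⟨a, i, j, hij, hsum, rfl⟩)
  · show freeCup F c _ ∈ milnorRel F (n + 1)
    rw [map_sub, map_sub, freeCup, FreeAbelianGroup.map_of_apply,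
      FreeAbelianGroup.map_of_apply, FreeAbelianGroup.map_of_apply]
    refine AddSubgroup.subset_closure (Or.inl
      ⟨Fin.snoc a c, i.castSucc, u, v, by rw [Fin.snoc_castSucc, hai], ?_⟩)
    rw [Fin.snoc_update, Fin.snoc_update]
  · show freeCup F c _ ∈ milnorRel F (n + 1)
    rw [freeCup, FreeAbelianGroup.map_of_apply]
    refine AddSubgroup.subset_closure
      (Or.inr ⟨Fin.snoc a c, i.castSucc, j.castSucc, by simpa using hij, ?_, rfl⟩)
    rw [Fin.snoc_castSucc, Fin.snoc_castSucc]
    exact hsum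

/-- Cup product with a unit, `K_n^M(F) → K_{n+1}^M(F)`. -/
def cupMilnor {n : ℕ} (c : Fˣ) : MilnorK F n →+ MilnorK F (n + 1) :=
  QuotientAddGroup.map _ _ (freeCup F c) (milnorRel_le_comap_cup F n c)

theorem pMul_le_comap_cup (p n : ℕ) (c : Fˣ) :
    pMul F p n ≤ (pMul F p (n + 1)).comap (cupMilnor F (n := n) c) := by
  rw [pMul, AddSubgroup.closure_le]
  rintro z ⟨y, rfl⟩
  exact AddSubgroup.subset_closure ⟨cupMilnor F c y, by rw [map_nsmul]⟩

/-- Cup product with the class of a unit, `k_n(F) → k_{n+1}(F)`;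
on symbols it is given by `(a_1, …, a_n) ∪ (c) = (a_1, …, a_n, c)`. -/
def cupUnit (p : ℕ) {n : ℕ} (c : Fˣ) : kMod F p n →+ kMod F p (n + 1) :=
  QuotientAddGroup.map _ _ (cupMilnor F c) (pMul_le_comap_cup F p n c)

end Cup

section Forms

variable {ι : Type} [Fintype ι]

/-- A form `N` splits a class `α ∈ k_n(F)` if for every field extension `L/F`,
isotropy of `N` over `L` implies that `α` becomes trivial in `k_n(L)`. -/
def SplitsClass (p : ℕ) (N : MvPolynomial ι F) {n : ℕ} (α : kMod F p n) : Prop :=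
  ∀ (L : Type u) [Field L] [Algebra F L],
    (∃ x : ι → L, x ≠ 0 ∧ MvPolynomial.aeval x N = 0) → resK F L p n α = 0

/-- A form `N` neutralizes a class `α ∈ k_n(F)` if for every field extension
`L/F` and every `x` with `N(x) ≠ 0`, the class `α_L ∪ (N(x))` vanishes. -/
def NeutralizesClass (p : ℕ) (N : MvPolynomial ι F) {n : ℕ} (α : kMod F p n) : Prop :=
  ∀ (L : Type u) [Field L] [Algebra F L] (x : ι → L) (h : MvPolynomial.aeval x N ≠ 0),
    cupUnit L p (Units.mk0 (MvPolynomial.aeval x N) h) (resK F L p n α) = 0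

end Forms

/-- The `n`-fold Pfister form `⟨⟨a_1, …, a_n⟩⟩ = ⟨1, -a_1⟩ ⊗ ⋯ ⊗ ⟨1, -a_n⟩`,
as a diagonal quadratic form in `2 ^ n` variables indexed by `Fin n → Bool`,
whose coefficients are the products of subsets of `{-a_1, …, -a_n}`. -/
noncomputable def pfisterForm (F : Type u) [Field F] {n : ℕ} (a : Fin n → Fˣ) :
    MvPolynomial (Fin n → Bool) F :=
  ∑ S : Fin n → Bool,
    MvPolynomial.C (∏ i : Fin n, if S i then -(a i : F) else 1) * MvPolynomial.X S ^ 2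

section SymbolCalculus

variable {K : Type u} [Field K] {p n : ℕ}

theorem symbol_eq_add_of_apply_eq_mul (a : Fin n → Kˣ) (i : Fin n) {u v : Kˣ}
    (h : a i = u * v) :
    symbol K p a = symbol K p (Function.update a i u) + symbol K p (Function.update a i v) := by
  have key : (QuotientAddGroup.mk (FreeAbelianGroup.of a) : MilnorK K n) =
      QuotientAddGroup.mk (FreeAbelianGroup.of (Function.update a i u) +
        FreeAbelianGroup.of (Function.update a i v)) := by
    refine (QuotientAddGroup.eq_iff_sub_mem).2 (AddSubgroup.subset_closure (Or.inl ?_))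
    exact ⟨a, i, u, v, h, by abel⟩
  exact congrArg (QuotientAddGroup.mk' (pMul K p n)) key

theorem symbol_eq_zero_of_add_eq_one (a : Fin n → Kˣ) {i j : Fin n} (hij : (i : ℕ) + 1 = j)
    (h : (a i : K) + a j = 1) : symbol K p a = 0 := by
  have key : (QuotientAddGroup.mk (FreeAbelianGroup.of a) : MilnorK K n) = 0 :=
    (QuotientAddGroup.eq_zero_iff _).2 (AddSubgroup.subset_closure (Or.inr ⟨a, i, j, hij, h, rfl⟩))
  exact congrArg (QuotientAddGroup.mk' (pMul K p n)) key

theorem nsmul_kMod_eq_zero (x : kMod K p n) : p • x = 0 := by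
  obtain ⟨y, rfl⟩ := QuotientAddGroup.mk_surjective x
  exact (QuotientAddGroup.eq_zero_iff _).2 (AddSubgroup.subset_closure ⟨y, rfl⟩)

theorem cupUnit_symbol (a : Fin n → Kˣ) (c : Kˣ) :
    cupUnit K p c (symbol K p a) = symbol K p (Fin.snoc a c : Fin (n + 1) → Kˣ) := rfl

theorem cupUnit_mul_symbol (a : Fin n → Kˣ) (u v : Kˣ) :
    cupUnit K p (u * v) (symbol K p a) =
      cupUnit K p u (symbol K p a) + cupUnit K p v (symbol K p a) := by
  simp only [cupUnit_symbol]
  rw [symbol_eq_add_of_apply_eq_mul (Fin.snoc a (u * v)) (Fin.last n) (Fin.snoc_last _ _),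
    Fin.update_snoc_last, Fin.update_snoc_last]

theorem cupUnit_one_symbol (a : Fin n → Kˣ) : cupUnit K p 1 (symbol K p a) = 0 := by
  simpa using cupUnit_mul_symbol (p := p) a 1 1

theorem cupUnit_inv_symbol (a : Fin n → Kˣ) (u : Kˣ) :
    cupUnit K p u⁻¹ (symbol K p a) = -cupUnit K p u (symbol K p a) := by
  have h := cupUnit_mul_symbol (p := p) a u⁻¹ u
  rw [inv_mul_cancel, cupUnit_one_symbol] at h
  exact eq_neg_of_add_eq_zero_left h.symm

theorem cupUnit_cupUnit_mul_symbol (a : Fin n → Kˣ) (c u v : Kˣ) :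
    cupUnit K p (u * v) (cupUnit K p c (symbol K p a)) =
      cupUnit K p u (cupUnit K p c (symbol K p a)) +
        cupUnit K p v (cupUnit K p c (symbol K p a)) :=
  cupUnit_mul_symbol (Fin.snoc a c : Fin (n + 1) → Kˣ) u v

theorem cupUnit_cupUnit_inv_symbol (a : Fin n → Kˣ) (c u : Kˣ) :
    cupUnit K p u⁻¹ (cupUnit K p c (symbol K p a)) =
      -cupUnit K p u (cupUnit K p c (symbol K p a)) :=
  cupUnit_inv_symbol (Fin.snoc a c : Fin (n + 1) → Kˣ) u

/-- The Steinberg relation for the last two entries of a symbol. -/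
theorem cupUnit_cupUnit_eq_zero_of_add_eq_one (a : Fin n → Kˣ) {u v : Kˣ}
    (h : (u : K) + v = 1) : cupUnit K p v (cupUnit K p u (symbol K p a)) = 0 := by
  rw [cupUnit_symbol, cupUnit_symbol]
  exact symbol_eq_zero_of_add_eq_one _ (i := (Fin.last n).castSucc) (j := Fin.last (n + 1))
    (by simp) (by simpa using h)

theorem cupUnit_neg_cupUnit_self (a : Fin n → Kˣ) (u : Kˣ) :
    cupUnit K p (-u) (cupUnit K p u (symbol K p a)) = 0 := by
  by_cases hu : u = 1
  · rw [hu, cupUnit_one_symbol, map_zero]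
  have hu' : (u : K) ≠ 1 := fun h => hu (Units.ext h)
  have hw : 1 - (u : K) ≠ 0 := sub_ne_zero.2 hu'.symm
  have hz : 1 - (u : K)⁻¹ ≠ 0 := sub_ne_zero.2 fun h => hu' (inv_eq_one.1 h.symm)
  set w := Units.mk0 _ hw
  set z := Units.mk0 _ hz
  have hquot : -u = w * z⁻¹ := by
    rw [eq_mul_inv_iff_mul_eq]
    ext
    simp only [w, z, Units.val_mul, Units.val_neg, Units.val_mk0]
    field_simp
    ring
  have h1 : cupUnit K p w (cupUnit K p u (symbol K p a)) = 0 :=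
    cupUnit_cupUnit_eq_zero_of_add_eq_one a (by simp [w])
  have h2 : cupUnit K p z (cupUnit K p u⁻¹ (symbol K p a)) = 0 :=
    cupUnit_cupUnit_eq_zero_of_add_eq_one a (by simp [z])
  rw [cupUnit_inv_symbol, map_neg, neg_eq_zero] at h2
  rw [hquot, cupUnit_cupUnit_mul_symbol, cupUnit_cupUnit_inv_symbol, h1, h2, neg_zero, add_zero]

/-- Symbols are antisymmetric in their last two entries. -/
theorem cupUnit_cupUnit_comm (a : Fin n → Kˣ) (u v : Kˣ) :
    cupUnit K p v (cupUnit K p u (symbol K p a)) =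
      -cupUnit K p u (cupUnit K p v (symbol K p a)) := by
  have h := cupUnit_neg_cupUnit_self (p := p) a (u * v)
  have hu := cupUnit_neg_cupUnit_self (p := p) a u
  have hv := cupUnit_neg_cupUnit_self (p := p) a v
  have e1 : -(u * v) = -u * v := by rw [neg_mul]
  have e2 : -(u * v) = u * -v := by rw [mul_neg]
  rw [cupUnit_mul_symbol, map_add] at h
  nth_rewrite 1 [e1] at h
  rw [e2, cupUnit_cupUnit_mul_symbol, cupUnit_cupUnit_mul_symbol, hu, hv, zero_add, add_zero] at h
  exact eq_neg_of_add_eq_zero_left h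

/-- If `b` and `c` neutralize a symbol, then so does `b - e * c` after adjoining `e`. -/
theorem cupUnit_cupUnit_eq_zero_of_eq_sub (a : Fin n → Kˣ) {b c d e : Kˣ}
    (hb : cupUnit K p b (symbol K p a) = 0) (hc : cupUnit K p c (symbol K p a) = 0)
    (hd : (d : K) = b - e * c) : cupUnit K p d (cupUnit K p e (symbol K p a)) = 0 := by
  have h : cupUnit K p (d * b⁻¹) (cupUnit K p (e * c * b⁻¹) (symbol K p a)) = 0 :=
    cupUnit_cupUnit_eq_zero_of_add_eq_one a (by
      simp only [Units.val_mul, Units.val_inv_eq_inv_val, hd]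
      field_simp
      ring)
  simpa [cupUnit_mul_symbol, cupUnit_inv_symbol, hb, hc, cupUnit_cupUnit_mul_symbol,
    cupUnit_cupUnit_inv_symbol, cupUnit_cupUnit_comm a e b] using h

end SymbolCalculus

section PfisterValue

variable {K : Type u} [Field K] {n : ℕ}

/-- The value of the Pfister form `⟨⟨a_1, …, a_n⟩⟩` at the vector `x`. -/
def pfisterValue (a : Fin n → Kˣ) (x : (Fin n → Bool) → K) : K :=
  ∑ S : Fin n → Bool, (∏ i : Fin n, if S i then -(a i : K) else 1) * x S ^ 2

theorem pfisterValue_zero (a : Fin 0 → Kˣ) (x : (Fin 0 → Bool) → K) :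
    pfisterValue a x = x default ^ 2 := by
  rw [pfisterValue, Fintype.sum_unique, Fin.prod_univ_zero, one_mul]
  exact congrArg (x · ^ 2) (Subsingleton.elim _ _)

theorem pfisterValue_snoc (a : Fin n → Kˣ) (e : Kˣ) (x : (Fin (n + 1) → Bool) → K) :
    pfisterValue (Fin.snoc a e : Fin (n + 1) → Kˣ) x =
      pfisterValue a (fun S => x (Fin.snoc S false : Fin (n + 1) → Bool)) -
        e * pfisterValue a (fun S => x (Fin.snoc S true : Fin (n + 1) → Bool)) := by
  unfold pfisterValue
  rw [← (Fin.snocEquiv fun _ : Fin (n + 1) => Bool).sum_comp, Fintype.sum_prod_type,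
    Fintype.sum_bool]
  simp only [Fin.snocEquiv_apply, Fin.prod_univ_castSucc, Fin.snoc_castSucc, Fin.snoc_last,
    Finset.mul_sum, if_true, Bool.false_eq_true, if_false, mul_one]
  rw [sub_eq_add_neg, add_comm, ← Finset.sum_neg_distrib]
  congr 1
  refine Finset.sum_congr rfl fun S _ => ?_
  change _ = -((e : K) * (_ * x (Fin.snocEquiv (fun _ : Fin (n + 1) => Bool) (true, S)) ^ 2))
  ring

theorem aeval_pfisterForm (F : Type u) [Field F] [Algebra F K] (a : Fin n → Fˣ)
    (x : (Fin n → Bool) → K) :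
    MvPolynomial.aeval x (pfisterForm F a) =
      pfisterValue (Units.map (algebraMap F K).toMonoidHom ∘ a) x := by
  simp only [pfisterForm, pfisterValue, map_sum, map_mul, map_pow, MvPolynomial.aeval_C,
    MvPolynomial.aeval_X, map_prod]
  refine Finset.sum_congr rfl fun S _ => ?_
  congr 1
  refine Finset.prod_congr rfl fun i _ => ?_
  split_ifs <;> simp

theorem cupUnit_symbol_eq_zero_of_pfisterValue_eq (a : Fin n → Kˣ) (x : (Fin n → Bool) → K)
    (d : Kˣ) (hd : pfisterValue a x = d) : cupUnit K 2 d (symbol K 2 a) = 0 := by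
  induction n generalizing d with
  | zero =>
    rw [pfisterValue_zero] at hd
    have hx : x default ≠ 0 := fun h => d.ne_zero (by rw [← hd, h, zero_pow two_ne_zero])
    have hsq : d = Units.mk0 _ hx * Units.mk0 _ hx := Units.ext (by simp [← hd, sq])
    rw [hsq, cupUnit_mul_symbol, ← two_nsmul, nsmul_kMod_eq_zero]
  | succ n ih =>
    obtain ⟨a, e, rfl⟩ : ∃ (b : Fin n → Kˣ) (e : Kˣ), a = Fin.snoc b e :=
      ⟨Fin.init a, a (Fin.last n), (Fin.snoc_init_self a).symm⟩
    rw [pfisterValue_snoc] at hd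
    rw [← cupUnit_symbol]
    set y : (Fin n → Bool) → K := fun S => x (Fin.snoc S false : Fin (n + 1) → Bool)
    set z : (Fin n → Bool) → K := fun S => x (Fin.snoc S true : Fin (n + 1) → Bool)
    by_cases hz : pfisterValue a z = 0
    · rw [hz, mul_zero, sub_zero] at hd
      rw [cupUnit_cupUnit_comm, ih a y d hd, map_zero, neg_zero]
    have hc := ih a z (Units.mk0 _ hz) rfl
    by_cases hy : pfisterValue a y = 0
    · have hd' : d = -e * Units.mk0 _ hz := Units.ext (by simp [← hd, hy])
      rw [hd', cupUnit_cupUnit_mul_symbol, cupUnit_neg_cupUnit_self, zero_add,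
        cupUnit_cupUnit_comm, hc, map_zero, neg_zero]
    · exact cupUnit_cupUnit_eq_zero_of_eq_sub a (ih a y (Units.mk0 _ hy) rfl) hc hd.symm

theorem symbol_eq_zero_of_pfisterValue_eq_zero (a : Fin n → Kˣ) (x : (Fin n → Bool) → K)
    (hx : x ≠ 0) (h : pfisterValue a x = 0) : symbol K 2 a = 0 := by
  induction n with
  | zero =>
    rw [pfisterValue_zero] at h
    refine absurd (funext fun S => ?_) hx
    rw [Subsingleton.elim S default]
    exact pow_eq_zero_iff two_ne_zero |>.1 h
  | succ n ih =>
    obtain ⟨a, e, rfl⟩ : ∃ (b : Fin n → Kˣ) (e : Kˣ), a = Fin.snoc b e :=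
      ⟨Fin.init a, a (Fin.last n), (Fin.snoc_init_self a).symm⟩
    rw [pfisterValue_snoc] at h
    rw [← cupUnit_symbol]
    set y : (Fin n → Bool) → K := fun S => x (Fin.snoc S false : Fin (n + 1) → Bool)
    set z : (Fin n → Bool) → K := fun S => x (Fin.snoc S true : Fin (n + 1) → Bool)
    by_cases hz : pfisterValue a z = 0
    · have hy : pfisterValue a y = 0 := by simpa [hz] using h
      have hyz : y ≠ 0 ∨ z ≠ 0 := by
        by_contra! hyz
        refine hx (funext fun S => ?_)
        rw [← Fin.snoc_init_self S]
        cases S (Fin.last n)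
        · exact congrFun hyz.1 (Fin.init S)
        · exact congrFun hyz.2 (Fin.init S)
      have ha : symbol K 2 a = 0 := hyz.elim (fun hne => ih a y hne hy) fun hne => ih a z hne hz
      rw [ha, map_zero]
    · have hc := cupUnit_symbol_eq_zero_of_pfisterValue_eq a z (Units.mk0 _ hz) rfl
      have hec := cupUnit_symbol_eq_zero_of_pfisterValue_eq a y (e * Units.mk0 _ hz)
        (by simpa using sub_eq_zero.1 h)
      rwa [cupUnit_mul_symbol, hc, add_zero] at hec

end PfisterValue

/-- Let `F` have characteristic different from `2`,
`α = (a_1, …, a_n) ∈ k_n(F)` and let `q = ⟨⟨a_1, …, a_n⟩⟩` be the corresponding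
`n`-fold Pfister form.  Then `q` splits `α` and `q` neutralizes `α`. -/
theorem pfister_splits_and_neutralizes (F : Type u) [Field F]
    (hchar : ringChar F ≠ 2) (n : ℕ) (a : Fin n → Fˣ) :
    SplitsClass F 2 (pfisterForm F a) (symbol F 2 a) ∧
    NeutralizesClass F 2 (pfisterForm F a) (symbol F 2 a) := by
  refine ⟨fun L _ _ ⟨x, hx, h⟩ => ?_, fun L _ _ x h => ?_⟩
  · exact symbol_eq_zero_of_pfisterValue_eq_zero
      (Units.map (algebraMap F L).toMonoidHom ∘ a) x hx (by rw [← aeval_pfisterForm, h])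
  · exact cupUnit_symbol_eq_zero_of_pfisterValue_eq
      (Units.map (algebraMap F L).toMonoidHom ∘ a) x _ (aeval_pfisterForm F a x).symm
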